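/- arXiv:1610.03654 — 2 statements merged into one kernel-verified Lean document; each statement's English description precedes it below -/
import Mathlib

section
/- Let p > 0 be a real number, let q ≥ 2 be an integer, let φ : ℝ² → ℝ be a smooth compactly supported function, and let α : ℝ → ℝ be a smooth function with α(x) = 1 for |x| ≤ 1 and α(x) = 0 for |x| ≥ 2. Define N⁽¹⁾(t) = ∫₀^∞ e^{i t x₂^q} L⁽²⁾(t; φ(·,x₂)) α(t^{1/q} x₂) dx₂ for t > 1. Then there exist constants C > 0 and t₀ > 1 such that |N⁽¹⁾(t)| ≤ C t^{−1/q} (log t)^{−(1/p+1)} for all t ≥ t₀. -/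
open MeasureTheory Filter

/-- `L⁽²⁾(t;ψ) = ∫_{(log t)^{-1/p}}^∞ e^{i t exp(-1/x^p)} ψ(x) dx`. -/
noncomputable def Ltwo (p t : ℝ) (ψ : ℝ → ℝ) : ℂ :=
  ∫ x in Set.Ioi ((Real.log t) ^ (-(1 / p))),
    Complex.exp (Complex.I * (t : ℂ) * ((Real.exp (-1 / x ^ p) : ℝ) : ℂ)) * ((ψ x : ℝ) : ℂ)

/-- `N⁽¹⁾(t) = ∫₀^∞ e^{i t x₂^q} L⁽²⁾(t; φ(·,x₂)) α(t^{1/q} x₂) dx₂`. -/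
noncomputable def None' (p : ℝ) (q : ℕ) (φ : ℝ × ℝ → ℝ) (α : ℝ → ℝ) (t : ℝ) : ℂ :=
  ∫ x₂ in Set.Ioi (0 : ℝ),
    Complex.exp (Complex.I * (t : ℂ) * ((x₂ ^ q : ℝ) : ℂ)) *
      Ltwo p t (fun x₁ => φ (x₁, x₂)) * ((α (t ^ (1 / (q : ℝ)) * x₂) : ℝ) : ℂ)

/-- The reciprocal of the derivative of `x ↦ exp (-1 / x ^ p)`. -/
noncomputable def invPhaseDeriv (p x : ℝ) : ℝ := x ^ (p + 1) * Real.exp (1 / x ^ p) / p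

lemma hasDerivAt_one_div_rpow (p : ℝ) {x : ℝ} (hx : 0 < x) :
    HasDerivAt (fun y : ℝ => 1 / y ^ p) (-p / x ^ (p + 1)) x := by
  have h := Real.hasDerivAt_rpow_const (x := x) (p := -p) (Or.inl hx.ne')
  have e : -p * x ^ (-p - 1) = -p / x ^ (p + 1) := by
    rw [show -p - 1 = -(p + 1) by ring, Real.rpow_neg hx.le, div_eq_mul_inv]
  rw [e] at h
  refine h.congr_of_eventuallyEq ?_
  filter_upwards [lt_mem_nhds hx] with y hy
  rw [Real.rpow_neg hy.le, one_div]

lemma hasDerivAt_exp_neg_one_div_rpow (p : ℝ) {x : ℝ} (hx : 0 < x) :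
    HasDerivAt (fun y : ℝ => Real.exp (-1 / y ^ p))
      (Real.exp (-1 / x ^ p) * (p / x ^ (p + 1))) x := by
  have h := (hasDerivAt_one_div_rpow p hx).neg.exp
  simpa only [Pi.neg_apply, neg_div, neg_neg] using h

lemma hasDerivAt_invPhaseDeriv {p : ℝ} (hp : 0 < p) {x : ℝ} (hx : 0 < x) :
    HasDerivAt (invPhaseDeriv p)
      (Real.exp (1 / x ^ p) * ((1 + 1 / p) * x ^ p - 1)) x := by
  have h1 := Real.hasDerivAt_rpow_const (x := x) (p := p + 1) (Or.inl hx.ne')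
  have h := (h1.mul (hasDerivAt_one_div_rpow p hx).exp).div_const p
  refine h.congr_deriv ?_
  have hx1 : 0 < x ^ (p + 1) := Real.rpow_pos_of_pos hx _
  rw [add_sub_cancel_right]
  field_simp
  ring

lemma deriv_invPhaseDeriv_le {p : ℝ} (hp : 0 < p) {x M : ℝ} (hx : 0 < x) (hxM : x ≤ M) :
    Real.exp (1 / x ^ p) * ((1 + 1 / p) * x ^ p - 1) ≤
      Real.exp (1 + 1 / p) * ((1 + 1 / p) * M ^ p) := by
  have hxp : 0 < x ^ p := Real.rpow_pos_of_pos hx _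
  have hM : x ^ p ≤ M ^ p := Real.rpow_le_rpow hx.le hxM hp.le
  have hc : 0 < 1 + 1 / p := by positivity
  have hR : 0 ≤ Real.exp (1 + 1 / p) * ((1 + 1 / p) * M ^ p) := by
    have := hxp.trans_le hM
    positivity
  rcases le_total ((1 + 1 / p) * x ^ p - 1) 0 with h | h
  · exact (mul_nonpos_of_nonneg_of_nonpos (Real.exp_pos _).le h).trans hR
  · have h1 : 1 / x ^ p ≤ 1 + 1 / p := by
      rw [div_le_iff₀ hxp]; linarith
    refine mul_le_mul (Real.exp_le_exp.2 h1) ?_ h (Real.exp_pos _).le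
    nlinarith

lemma continuousOn_deriv_invPhaseDeriv {p : ℝ} (hp : 0 < p) :
    ContinuousOn (fun x : ℝ => Real.exp (1 / x ^ p) * ((1 + 1 / p) * x ^ p - 1))
      (Set.Ioi 0) := by
  have h : ContinuousOn (fun x : ℝ => x ^ p) (Set.Ioi 0) := by
    intro x _
    exact (Real.continuousAt_rpow_const x p (Or.inr hp.le)).continuousWithinAt
  have h' : ContinuousOn (fun x : ℝ => 1 / x ^ p) (Set.Ioi 0) :=
    continuousOn_const.div h fun x hx => (Real.rpow_pos_of_pos hx _).ne'
  fun_prop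

/-- If `G' ≤ K` on `[a, b]`, then `G ≤ G a + K (b - a)` there. -/
lemma le_add_mul_of_deriv_le {G G' : ℝ → ℝ} {a b K : ℝ} (hK : 0 ≤ K)
    (hG : ∀ x ∈ Set.Icc a b, HasDerivAt G (G' x) x) (hG' : ∀ x ∈ Set.Icc a b, G' x ≤ K)
    {x : ℝ} (hx : x ∈ Set.Icc a b) : G x ≤ G a + K * (b - a) := by
  have h := (convex_Icc a b).image_sub_le_mul_sub_of_deriv_le (f := G) (C := K)
    (fun y hy => (hG y hy).continuousAt.continuousWithinAt)
    (fun y hy => (hG y (interior_subset hy)).differentiableAt.differentiableWithinAt)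
    (fun y hy => by
      rw [(hG y (interior_subset hy)).deriv]; exact hG' y (interior_subset hy))
    a ⟨le_rfl, hx.1.trans hx.2⟩ x hx hx.1
  nlinarith [mul_le_mul_of_nonneg_left (sub_le_sub_right hx.2 a) hK]

/-- A first-derivative test: `G` is the reciprocal of the derivative of the phase `h`,
and `G'` is only bounded from above. -/
lemma norm_integral_exp_mul_le {h G G' ψ ψ' : ℝ → ℝ} {a b t K B : ℝ} (hab : a ≤ b) (ht : 0 < t)
    (hK : 0 ≤ K) (hh : ∀ x ∈ Set.Icc a b, HasDerivAt h (G x)⁻¹ x)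
    (hG0 : ∀ x ∈ Set.Icc a b, 0 < G x)
    (hG : ∀ x ∈ Set.Icc a b, HasDerivAt G (G' x) x) (hG'c : ContinuousOn G' (Set.Icc a b))
    (hG' : ∀ x ∈ Set.Icc a b, G' x ≤ K)
    (hψ : ∀ x, HasDerivAt ψ (ψ' x) x) (hψ'c : Continuous ψ')
    (hB : ∀ x, |ψ x| ≤ B) (hB' : ∀ x, |ψ' x| ≤ B) (hψb : ψ b = 0) :
    ‖∫ x in a..b, Complex.exp (Complex.I * (t : ℂ) * ((h x : ℝ) : ℂ)) * ((ψ x : ℝ) : ℂ)‖ ≤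
      B * (2 + (b - a)) * (G a + 2 * K * (b - a)) / t := by
  have hB0 : 0 ≤ B := (abs_nonneg _).trans (hB 0)
  have hu : Set.uIcc a b = Set.Icc a b := Set.uIcc_of_le hab
  set E : ℝ → ℂ := fun x => Complex.exp (Complex.I * (t : ℂ) * ((h x : ℝ) : ℂ)) with hE
  have hEn : ∀ x, ‖E x‖ = 1 := fun x => by
    rw [hE]; dsimp only
    rw [show Complex.I * (t : ℂ) * ((h x : ℝ) : ℂ) = ((t * h x : ℝ) : ℂ) * Complex.I by
      push_cast; ring]
    exact Complex.norm_exp_ofReal_mul_I _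
  have hED : ∀ x ∈ Set.Icc a b,
      HasDerivAt E (E x * (Complex.I * (t : ℂ) * (((G x)⁻¹ : ℝ) : ℂ))) x := fun x hx =>
    ((hh x hx).ofReal_comp.const_mul (Complex.I * (t : ℂ))).cexp
  have hEc : ContinuousOn E (Set.Icc a b) := fun x hx =>
    (hED x hx).continuousAt.continuousWithinAt
  have hGc : ContinuousOn G (Set.Icc a b) := fun x hx =>
    (hG x hx).continuousAt.continuousWithinAt
  have hψc : Continuous ψ := continuous_iff_continuousAt.2 fun x => (hψ x).continuousAt
  have hitn : ‖Complex.I * (t : ℂ)‖ = t := by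
    rw [norm_mul, Complex.norm_I, one_mul, Complex.norm_real, Real.norm_of_nonneg ht.le]
  set R : ℝ → ℝ := fun x => ψ' x * G x + ψ x * G' x with hR
  have hF : ∀ x ∈ Set.uIcc a b,
      HasDerivAt (fun x => E x * ((ψ x * G x : ℝ) : ℂ))
        (Complex.I * (t : ℂ) * (E x * (ψ x : ℂ)) + E x * (R x : ℂ)) x := fun x hx => by
    rw [hu] at hx
    have h1 := (hED x hx).mul ((hψ x).mul (hG x hx)).ofReal_comp
    refine h1.congr_deriv ?_
    have : (G x : ℂ) ≠ 0 := Complex.ofReal_ne_zero.2 (hG0 x hx).ne'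
    simp only [hR, Pi.mul_apply]
    push_cast
    field_simp
  have hRc : ContinuousOn R (Set.Icc a b) :=
    (hψ'c.continuousOn.mul hGc).add (hψc.continuousOn.mul hG'c)
  have hψcC : Continuous fun x => (ψ x : ℂ) := Complex.continuous_ofReal.comp hψc
  have i1 : IntervalIntegrable (fun x => Complex.I * (t : ℂ) * (E x * (ψ x : ℂ))) volume a b :=
    ContinuousOn.intervalIntegrable (by
      rw [hu]; exact continuousOn_const.mul (hEc.mul hψcC.continuousOn))
  have i2 : IntervalIntegrable (fun x => E x * (R x : ℂ)) volume a b :=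
    ContinuousOn.intervalIntegrable (by
      rw [hu]; exact hEc.mul (Complex.continuous_ofReal.comp_continuousOn hRc))
  have key := intervalIntegral.integral_eq_sub_of_hasDerivAt hF (i1.add i2)
  rw [intervalIntegral.integral_add i1 i2, intervalIntegral.integral_const_mul] at key
  simp only [hψb, zero_mul, Complex.ofReal_zero, mul_zero, zero_sub] at key
  have hGle : ∀ x ∈ Set.Icc a b, G x ≤ G a + K * (b - a) := fun x hx =>
    le_add_mul_of_deriv_le hK hG hG' hx
  have iG' : IntervalIntegrable G' volume a b :=
    ContinuousOn.intervalIntegrable (by rw [hu]; exact hG'c)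
  have hRint : ‖∫ x in a..b, E x * (R x : ℂ)‖ ≤
      ∫ x in a..b, (B * (G a + K * (b - a)) + B * (2 * K)) - B * G' x := by
    refine intervalIntegral.norm_integral_le_of_norm_le hab ?_ ?_
    · refine Filter.Eventually.of_forall fun x hx => ?_
      have hx' : x ∈ Set.Icc a b := Set.Ioc_subset_Icc_self hx
      rw [norm_mul, hEn, one_mul, Complex.norm_real, Real.norm_eq_abs]
      have e1 : |ψ' x * G x| ≤ B * (G a + K * (b - a)) := by
        rw [abs_mul, abs_of_pos (hG0 x hx')]
        exact mul_le_mul (hB' x) (hGle x hx') (hG0 x hx').le hB0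
      have e3 : |G' x| ≤ 2 * K - G' x := by
        have := hG' x hx'
        exact abs_le.2 ⟨by linarith, by linarith⟩
      have e2 : |ψ x * G' x| ≤ B * (2 * K - G' x) := by
        rw [abs_mul]
        exact mul_le_mul (hB x) e3 (abs_nonneg _) hB0
      have := abs_add_le (ψ' x * G x) (ψ x * G' x)
      simp only [hR]
      linarith
    · exact intervalIntegrable_const.sub (iG'.const_mul B)
  have hG'int : ∫ x in a..b, G' x = G b - G a :=
    intervalIntegral.integral_eq_sub_of_hasDerivAt (by rw [hu]; exact hG) iG'
  rw [intervalIntegral.integral_sub intervalIntegrable_const (iG'.const_mul B),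
    intervalIntegral.integral_const_mul, hG'int, intervalIntegral.integral_const,
    smul_eq_mul] at hRint
  have haa : a ∈ Set.Icc a b := ⟨le_rfl, hab⟩
  have hbb : b ∈ Set.Icc a b := ⟨hab, le_rfl⟩
  have hFa : ‖E a * ((ψ a * G a : ℝ) : ℂ)‖ ≤ B * G a := by
    rw [norm_mul, hEn, one_mul, Complex.norm_real, Real.norm_eq_abs, abs_mul,
      abs_of_pos (hG0 a haa)]
    exact mul_le_mul_of_nonneg_right (hB a) (hG0 a haa).le
  rw [le_div_iff₀ ht]
  have hn : ‖∫ x in a..b, E x * (ψ x : ℂ)‖ * t ≤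
      ‖E a * ((ψ a * G a : ℝ) : ℂ)‖ + ‖∫ x in a..b, E x * (R x : ℂ)‖ := by
    rw [mul_comm, ← hitn, ← norm_mul, eq_sub_of_add_eq key]
    refine (norm_sub_le _ _).trans ?_
    rw [norm_neg]
  refine hn.trans ((add_le_add hFa hRint).trans ?_)
  have hd : 0 ≤ b - a := sub_nonneg.2 hab
  have n1 : 0 ≤ B * G b := mul_nonneg hB0 (hG0 b hbb).le
  have n2 : 0 ≤ B * (K * (b - a) * (b - a)) := by positivity
  have n3 : 0 ≤ B * (K * (b - a)) := by positivity
  nlinarith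

lemma rpow_log_le_mul {s t : ℝ} (hs : 0 < s) (ht : 1 ≤ t) : Real.log t ^ s ≤ s ^ s * t := by
  have h0 : 0 ≤ t := by linarith
  have h := Real.log_le_rpow_div h0 (one_div_pos.2 hs)
  refine (Real.rpow_le_rpow (Real.log_nonneg ht) h hs.le).trans (le_of_eq ?_)
  rw [div_div_eq_mul_div, div_one, Real.mul_rpow (Real.rpow_nonneg h0 _) hs.le,
    ← Real.rpow_mul h0, one_div_mul_cancel hs.ne', Real.rpow_one, mul_comm]

lemma invPhaseDeriv_rpow_log {p t : ℝ} (hp : 0 < p) (ht : 1 < t) :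
    invPhaseDeriv p (Real.log t ^ (-(1 / p))) = t * Real.log t ^ (-(1 / p + 1)) / p := by
  have hl : 0 < Real.log t := Real.log_pos ht
  unfold invPhaseDeriv
  rw [← Real.rpow_mul hl.le, ← Real.rpow_mul hl.le,
    show -(1 / p) * p = -1 by field_simp, show -(1 / p) * (p + 1) = -(1 / p + 1) by field_simp; ring,
    Real.rpow_neg_one, one_div (Real.log t)⁻¹, inv_inv, Real.exp_log (by linarith), mul_comm]

lemma exists_norm_Ltwo_le {p : ℝ} (hp : 0 < p) {M B : ℝ} (hM : 1 ≤ M) (hB0 : 0 ≤ B) :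
    ∃ C : ℝ, 0 ≤ C ∧ ∀ t ≥ Real.exp 1, ∀ ψ ψ' : ℝ → ℝ, (∀ x, HasDerivAt ψ (ψ' x) x) →
      Continuous ψ' → (∀ x, |ψ x| ≤ B) → (∀ x, |ψ' x| ≤ B) → (∀ x, M ≤ x → ψ x = 0) →
      ‖Ltwo p t ψ‖ ≤ C * Real.log t ^ (-(1 / p + 1)) := by
  set K : ℝ := Real.exp (1 + 1 / p) * ((1 + 1 / p) * M ^ p) with hKdef
  have hM0 : 0 < M := by linarith
  have hK : 0 ≤ K := by positivity
  set s : ℝ := 1 / p + 1 with hs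
  have hs0 : 0 < s := by positivity
  refine ⟨B * (2 + M) * (1 / p + 2 * K * M * s ^ s), by positivity, ?_⟩
  intro t ht ψ ψ' hψ hψ'c hB hB' hψM
  have ht1 : 1 < t := lt_of_lt_of_le (by simp) ht
  have ht0 : 0 < t := by linarith
  have hl1 : 1 ≤ Real.log t := by rwa [Real.le_log_iff_exp_le ht0]
  have hl0 : 0 < Real.log t := by linarith
  set a : ℝ := Real.log t ^ (-(1 / p)) with ha
  have ha0 : 0 < a := Real.rpow_pos_of_pos hl0 _
  have ha1 : a ≤ 1 := Real.rpow_le_one_of_one_le_of_nonpos hl1 (by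
    have : 0 < 1 / p := by positivity
    linarith)
  have haM : a ≤ M := ha1.trans hM
  have hpos : ∀ x ∈ Set.Icc a M, 0 < x := fun x hx => ha0.trans_le hx.1
  have hL : Ltwo p t ψ = ∫ x in a..M,
      Complex.exp (Complex.I * (t : ℂ) * ((Real.exp (-1 / x ^ p) : ℝ) : ℂ)) * ((ψ x : ℝ) : ℂ) := by
    rw [intervalIntegral.integral_of_le haM]
    refine setIntegral_eq_of_subset_of_forall_sdiff_eq_zero measurableSet_Ioi
      Set.Ioc_subset_Ioi_self fun x hx => ?_
    have : M ≤ x := by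
      by_contra! hc
      exact hx.2 ⟨hx.1, hc.le⟩
    rw [hψM x this, Complex.ofReal_zero, mul_zero]
  have main := norm_integral_exp_mul_le (h := fun x => Real.exp (-1 / x ^ p))
    (G := invPhaseDeriv p) (B := B) haM ht0 hK
    (fun x hx => by
      have h0 := hpos x hx
      refine (hasDerivAt_exp_neg_one_div_rpow p h0).congr_deriv ?_
      rw [invPhaseDeriv, neg_div, Real.exp_neg, inv_div, ← div_div, div_eq_mul_inv _ (Real.exp _)]
      ring)
    (fun x hx => by
      have h0 := hpos x hx
      unfold invPhaseDeriv; positivity)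
    (fun x hx => hasDerivAt_invPhaseDeriv hp (hpos x hx))
    ((continuousOn_deriv_invPhaseDeriv hp).mono hpos)
    (fun x hx => deriv_invPhaseDeriv_le hp (hpos x hx) hx.2)
    hψ hψ'c hB hB' (hψM M le_rfl)
  rw [hL]
  refine main.trans ?_
  rw [invPhaseDeriv_rpow_log hp ht1, ← hs]
  set l : ℝ := Real.log t ^ (-s) with hldef
  have hlpos : 0 < l := Real.rpow_pos_of_pos hl0 _
  have hone : 1 ≤ s ^ s * t * l := by
    have h1 := rpow_log_le_mul hs0 ht1.le
    rw [hldef, Real.rpow_neg hl0.le, ← div_eq_mul_inv, le_div_iff₀ (Real.rpow_pos_of_pos hl0 _),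
      one_mul]
    exact h1
  rw [div_le_iff₀ ht0]
  have hd : M - a ≤ M := by linarith
  have hd0 : 0 ≤ M - a := by linarith
  calc B * (2 + (M - a)) * (t * l / p + 2 * K * (M - a))
      ≤ B * (2 + M) * (t * l / p + 2 * K * M * (s ^ s * t * l)) := by
        refine mul_le_mul (by gcongr) ?_ (by positivity) (by positivity)
        refine add_le_add le_rfl ?_
        calc 2 * K * (M - a) ≤ 2 * K * M := by gcongr
          _ ≤ 2 * K * M * (s ^ s * t * l) := le_mul_of_one_le_right (by positivity) hone
    _ = _ := by ring

lemma exists_abs_le_of_forall_eq_zero {α : ℝ → ℝ} (hα : Continuous α)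
    (hα0 : ∀ x : ℝ, 2 ≤ |x| → α x = 0) : ∃ A : ℝ, 0 ≤ A ∧ ∀ x, |α x| ≤ A := by
  obtain ⟨A, hA⟩ := hα.bounded_above_of_compact_support
    (HasCompactSupport.intro (isCompact_Icc (a := (-2 : ℝ)) (b := 2)) fun x hx => hα0 x (by
      by_contra! hc
      exact hx ⟨(abs_lt.1 hc).1.le, (abs_lt.1 hc).2.le⟩))
  exact ⟨A, (norm_nonneg _).trans (hA 0), hA⟩

theorem stmt17 (p : ℝ) (hp : 0 < p) (q : ℕ) (hq : 2 ≤ q)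
    (φ : ℝ × ℝ → ℝ) (hφ : ContDiff ℝ (⊤ : ℕ∞) φ) (hφc : HasCompactSupport φ)
    (α : ℝ → ℝ) (hα : ContDiff ℝ (⊤ : ℕ∞) α)
    (hα1 : ∀ x : ℝ, |x| ≤ 1 → α x = 1) (hα0 : ∀ x : ℝ, 2 ≤ |x| → α x = 0) :
    ∃ C > (0 : ℝ), ∃ t₀ > (1 : ℝ), ∀ t ≥ t₀,
      ‖None' p q φ α t‖ ≤ C * t ^ (-(1 / (q : ℝ))) * (Real.log t) ^ (-(1 / p + 1)) := by
  obtain ⟨A, hA0, hA⟩ := exists_abs_le_of_forall_eq_zero hα.continuous hα0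
  obtain ⟨B₁, hB₁⟩ := hφ.continuous.bounded_above_of_compact_support hφc
  have hφ'c : Continuous (fderiv ℝ φ) := hφ.continuous_fderiv (by simp)
  obtain ⟨B₂, hB₂⟩ := hφ'c.bounded_above_of_compact_support (hφc.fderiv ℝ)
  obtain ⟨M, hM1, hM⟩ := hφc.isCompact.isBounded.subset_ball_lt 1 0
  have hB0 : 0 ≤ max B₁ B₂ := ((norm_nonneg _).trans (hB₁ 0)).trans (le_max_left _ _)
  obtain ⟨C, hC0, hC⟩ := exists_norm_Ltwo_le hp hM1.le hB0
  refine ⟨2 * C * A + 1, by positivity, Real.exp 1, by simp, fun t ht => ?_⟩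
  have ht1 : 1 < t := lt_of_lt_of_le (by simp) ht
  have ht0 : 0 < t := by linarith
  have hl0 : 0 < Real.log t := Real.log_pos ht1
  set l : ℝ := Real.log t ^ (-(1 / p + 1)) with hl
  have hlpos : 0 < l := Real.rpow_pos_of_pos hl0 _
  set r : ℝ := t ^ (-(1 / (q : ℝ))) with hr
  have hrpos : 0 < r := Real.rpow_pos_of_pos ht0 _
  have hLtwo : ∀ x₂ : ℝ, ‖Ltwo p t (fun x₁ => φ (x₁, x₂))‖ ≤ C * l := fun x₂ => by
    refine hC t ht _ (fun x => fderiv ℝ φ (x, x₂) (1, 0)) (fun x => ?_) ?_ (fun x => ?_)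
      (fun x => ?_) (fun x hx => ?_)
    · have h1 := (hφ.differentiable (by simp) (x, x₂)).hasFDerivAt
      exact h1.comp_hasDerivAt x ((hasDerivAt_id x).prodMk (hasDerivAt_const x x₂))
    · fun_prop
    · exact (hB₁ _).trans (le_max_left _ _)
    · refine ((fderiv ℝ φ (x, x₂)).le_opNorm _).trans ?_
      refine le_trans ?_ ((hB₂ (x, x₂)).trans (le_max_right _ _))
      simp [Prod.norm_def]
    · by_contra hne
      have hmem := hM (subset_tsupport φ hne)
      rw [mem_ball_zero_iff] at hmem
      have h2 : |x| ≤ ‖(x, x₂)‖ := norm_fst_le (x, x₂)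
      linarith [le_abs_self x]
  have hsub : None' p q φ α t = ∫ x₂ in Set.Ioc (0 : ℝ) (2 * r),
      Complex.exp (Complex.I * (t : ℂ) * ((x₂ ^ q : ℝ) : ℂ)) *
        Ltwo p t (fun x₁ => φ (x₁, x₂)) * ((α (t ^ (1 / (q : ℝ)) * x₂) : ℝ) : ℂ) := by
    refine setIntegral_eq_of_subset_of_forall_sdiff_eq_zero measurableSet_Ioi
      Set.Ioc_subset_Ioi_self fun x hx => ?_
    have hx2 : 2 * r < x := by
      by_contra! hc
      exact hx.2 ⟨hx.1, hc⟩
    have hT : 0 < t ^ (1 / (q : ℝ)) := Real.rpow_pos_of_pos ht0 _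
    have h2 : 2 ≤ t ^ (1 / (q : ℝ)) * x := by
      rw [hr, Real.rpow_neg ht0.le, ← div_eq_mul_inv, div_lt_iff₀ hT] at hx2
      linarith
    rw [hα0 _ (h2.trans (le_abs_self _)), Complex.ofReal_zero, mul_zero]
  have hbound : ‖None' p q φ α t‖ ≤ C * l * A * volume.real (Set.Ioc (0 : ℝ) (2 * r)) := by
    rw [hsub]
    refine norm_setIntegral_le_of_norm_le_const measure_Ioc_lt_top fun x _ => ?_
    have he : ‖Complex.exp (Complex.I * (t : ℂ) * ((x ^ q : ℝ) : ℂ))‖ = 1 := by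
      rw [show Complex.I * (t : ℂ) * ((x ^ q : ℝ) : ℂ) = ((t * x ^ q : ℝ) : ℂ) * Complex.I by
        push_cast; ring]
      exact Complex.norm_exp_ofReal_mul_I _
    rw [norm_mul, norm_mul, he, one_mul, Complex.norm_real]
    exact mul_le_mul (hLtwo x) (hA _) (norm_nonneg _) (by positivity)
  rw [Real.volume_real_Ioc_of_le (by positivity)] at hbound
  have : 0 < r * l := by positivity
  linarith
end

section
/- Let p > 0 be a real number, let q ≥ 2 be an integer, let φ : ℝ² → ℝ be a smooth compactly supported function, and let β : ℝ → ℝ be a smooth function with β(x) = 0 for |x| ≤ 1 and β(x) = 1 for |x| ≥ 2. Define N⁽²⁾(t) = ∫₀^∞ e^{i t x₂^q} L⁽²⁾(t; φ(·,x₂)) β(t^{1/q} x₂) dx₂ for t > 1. Then there exist constants C > 0 and t₀ > 1 such that |N⁽²⁾(t)| ≤ C t^{−1/q} (log t)^{−(1/p+1)} for all t ≥ t₀. -/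
open MeasureTheory Filter

/-- `N⁽²⁾(t) = ∫₀^∞ e^{i t x₂^q} L⁽²⁾(t; φ(·,x₂)) β(t^{1/q} x₂) dx₂`. -/
noncomputable def Ntwo (p : ℝ) (q : ℕ) (φ : ℝ × ℝ → ℝ) (β : ℝ → ℝ) (t : ℝ) : ℂ :=
  ∫ x₂ in Set.Ioi (0 : ℝ),
    Complex.exp (Complex.I * (t : ℂ) * ((x₂ ^ q : ℝ) : ℂ)) *
      Ltwo p t (fun x₁ => φ (x₁, x₂)) * ((β (t ^ (1 / (q : ℝ)) * x₂) : ℝ) : ℂ)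

open intervalIntegral in
/-- First derivative test for an oscillatory integral with phase `F`; the function `u` is the reciprocal of the derivative of the phase. -/
theorem norm_integral_exp_phase_le {a b K : ℝ} (hab : a ≤ b) (hK : 0 ≤ K) {F F' u u' : ℝ → ℝ}
    (hF : ∀ x ∈ Set.Icc a b, HasDerivAt F (F' x) x)
    (hu : ∀ x ∈ Set.Icc a b, HasDerivAt u (u' x) x)
    (huF : ∀ x ∈ Set.Icc a b, F' x * u x = 1)
    (hu0 : ∀ x ∈ Set.Icc a b, 0 ≤ u x)
    (hu'c : ContinuousOn u' (Set.Icc a b))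
    (hu'K : ∀ x ∈ Set.Icc a b, u' x ≤ K) :
    ‖∫ x in a..b, Complex.exp (Complex.I * (F x : ℂ))‖ ≤ 2 * u a + 2 * K * (b - a) := by
  have hI : Set.uIcc a b = Set.Icc a b := Set.uIcc_of_le hab
  have hFc : ContinuousOn F (Set.Icc a b) := fun x hx => (hF x hx).continuousAt.continuousWithinAt
  have hec : ContinuousOn (fun x => Complex.exp (Complex.I * (F x : ℂ))) (Set.Icc a b) := by
    fun_prop
  have hnorm : ∀ x, ‖Complex.exp (Complex.I * (F x : ℂ))‖ = 1 := fun x => by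
    rw [mul_comm]; exact Complex.norm_exp_ofReal_mul_I _
  have hi1 : IntervalIntegrable (fun x => Complex.exp (Complex.I * (F x : ℂ))) volume a b :=
    (hI ▸ hec).intervalIntegrable
  have hi2 : IntervalIntegrable (fun x => Complex.exp (Complex.I * (F x : ℂ)) * (u' x : ℂ))
      volume a b := by
    apply ContinuousOn.intervalIntegrable
    rw [hI]; fun_prop
  have hi3 : IntervalIntegrable u' volume a b := (hI ▸ hu'c).intervalIntegrable
  have key := integral_eq_sub_of_hasDerivAt
    (f := fun x => Complex.exp (Complex.I * (F x : ℂ)) * (u x : ℂ))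
    (f' := fun x => Complex.I * Complex.exp (Complex.I * (F x : ℂ))
      + Complex.exp (Complex.I * (F x : ℂ)) * (u' x : ℂ)) (a := a) (b := b)
    (fun x hx => by
      rw [hI] at hx
      have h1 := (((hF x hx).ofReal_comp.const_mul Complex.I).cexp).mul (hu x hx).ofReal_comp
      refine h1.congr_deriv ?_
      have h2 : ((F' x : ℝ) : ℂ) * ((u x : ℝ) : ℂ) = 1 := by exact_mod_cast huF x hx
      linear_combination (Complex.I * Complex.exp (Complex.I * (F x : ℂ))) * h2)
    ((hi1.const_mul _).add hi2)
  rw [integral_add (hi1.const_mul _) hi2, intervalIntegral.integral_const_mul] at key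
  have hu'int : ∫ x in a..b, u' x = u b - u a :=
    integral_eq_sub_of_hasDerivAt (fun x hx => hu x (hI ▸ hx)) hi3
  have hb2 : ‖∫ x in a..b, Complex.exp (Complex.I * (F x : ℂ)) * (u' x : ℂ)‖
      ≤ 2 * K * (b - a) - (u b - u a) := by
    calc _ ≤ ∫ x in a..b, (2 * K - u' x) := by
          apply norm_integral_le_of_norm_le hab
          · refine Eventually.of_forall fun x hx => ?_
            rw [norm_mul, hnorm, one_mul, Complex.norm_real, Real.norm_eq_abs, abs_le]
            have := hu'K x (Set.Ioc_subset_Icc_self hx)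
            constructor <;> linarith
          · exact intervalIntegrable_const.sub hi3
      _ = _ := by
          rw [integral_sub intervalIntegrable_const hi3, hu'int]
          simp; ring
  have hua := hu0 a (Set.left_mem_Icc.2 hab)
  have hub := hu0 b (Set.right_mem_Icc.2 hab)
  calc _ = ‖Complex.I * ∫ x in a..b, Complex.exp (Complex.I * (F x : ℂ))‖ := by simp
    _ = ‖Complex.exp (Complex.I * (F b : ℂ)) * (u b : ℂ)
          - Complex.exp (Complex.I * (F a : ℂ)) * (u a : ℂ)
          - ∫ x in a..b, Complex.exp (Complex.I * (F x : ℂ)) * (u' x : ℂ)‖ := by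
        rw [← key]; congr 1; ring
    _ ≤ u b + u a + (2 * K * (b - a) - (u b - u a)) := by
        refine (norm_sub_le _ _).trans (add_le_add ((norm_sub_le _ _).trans ?_) hb2)
        rw [norm_mul, norm_mul, hnorm, hnorm, one_mul, one_mul, Complex.norm_real,
          Complex.norm_real, Real.norm_of_nonneg hua, Real.norm_of_nonneg hub]
    _ = _ := by ring

open intervalIntegral in
/-- Insertion of a `C¹` amplitude vanishing at the right end point, by integration by parts. -/
theorem norm_integral_mul_amplitude_le {a b A D : ℝ} (hab : a ≤ b) {h ψ ψ' : ℝ → ℂ}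
    (hh : ContinuousOn h (Set.Icc a b))
    (hA : ∀ s ∈ Set.Icc a b, ‖∫ x in a..s, h x‖ ≤ A)
    (hψ : ∀ x, HasDerivAt ψ (ψ' x) x) (hψ' : Continuous ψ')
    (hD : ∀ x, ‖ψ' x‖ ≤ D) (hb : ψ b = 0) :
    ‖∫ x in a..b, h x * ψ x‖ ≤ A * D * (b - a) := by
  have hI : Set.uIcc a b = Set.Icc a b := Set.uIcc_of_le hab
  have hhi : IntervalIntegrable h volume a b := (hI ▸ hh).intervalIntegrable
  have hA0 : 0 ≤ A := (norm_nonneg _).trans (hA a (Set.left_mem_Icc.2 hab))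
  have hHc : ContinuousOn (fun s => ∫ x in a..s, h x) (Set.uIcc a b) :=
    continuousOn_primitive_interval' hhi Set.left_mem_uIcc
  have hψc : Continuous ψ := continuous_iff_continuousAt.2 fun x => (hψ x).continuousAt
  have key := integral_deriv_mul_eq_sub_of_hasDerivAt (a := a) (b := b)
    (u := fun s => ∫ x in a..s, h x) (u' := h) (v := ψ) (v' := ψ')
    hHc hψc.continuousOn
    (fun x hx => by
      rw [min_eq_left hab, max_eq_right hab] at hx
      have hx' : Set.Icc a b ∈ nhds x := Icc_mem_nhds hx.1 hx.2
      refine integral_hasDerivAt_right ?_ ?_ (hh.continuousAt hx')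
      · exact hhi.mono_set (Set.uIcc_subset_uIcc Set.left_mem_uIcc
          (hI ▸ Set.Ioo_subset_Icc_self hx))
      · exact (hh.mono Set.Ioo_subset_Icc_self).stronglyMeasurableAtFilter isOpen_Ioo x hx)
    (fun x _ => hψ x) hhi (hψ'.intervalIntegrable _ _)
  have hi1 : IntervalIntegrable (fun x => h x * ψ x) volume a b := by
    apply ContinuousOn.intervalIntegrable
    rw [hI]; fun_prop
  have hi2 : IntervalIntegrable (fun x => (∫ z in a..x, h z) * ψ' x) volume a b :=
    (hHc.mul hψ'.continuousOn).intervalIntegrable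
  rw [integral_add hi1 hi2] at key
  simp only [hb, mul_zero, integral_same, zero_mul, sub_zero] at key
  rw [eq_neg_of_add_eq_zero_left key, norm_neg]
  have := norm_integral_le_of_norm_le_const (a := a) (b := b) (C := A * D)
    (f := fun x => (∫ z in a..x, h z) * ψ' x) (fun x hx => by
      rw [Set.uIoc_of_le hab] at hx
      rw [norm_mul]
      exact mul_le_mul (hA x (Set.Ioc_subset_Icc_self hx)) (hD x) (norm_nonneg _) hA0)
  rwa [abs_of_nonneg (sub_nonneg.2 hab)] at this

/-- Differentiation of an integral over a compact interval with respect to a parameter. -/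
theorem hasDerivAt_integral_mul_slice {a b : ℝ} (hab : a ≤ b) {k : ℝ → ℂ}
    (hk : ContinuousOn k (Set.Icc a b))
    {φ : ℝ × ℝ → ℝ} (hφ : ContDiff ℝ (⊤ : ℕ∞) φ) (hφc : HasCompactSupport φ) (y : ℝ) :
    HasDerivAt (fun y => ∫ x in a..b, k x * ((φ (x, y) : ℝ) : ℂ))
      (∫ x in a..b, k x * ((fderiv ℝ φ (x, y) (0, 1) : ℝ) : ℂ)) y := by
  have hI : Set.uIcc a b = Set.Icc a b := Set.uIcc_of_le hab
  have hφ' : Continuous fun z => fderiv ℝ φ z (0, 1) :=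
    (hφ.continuous_fderiv (by simp)).clm_apply continuous_const
  obtain ⟨D, hD⟩ := (hφc.fderiv (𝕜 := ℝ)).exists_bound_of_continuous
    (hφ.continuous_fderiv (by simp))
  have hφ0 := hφ.continuous
  obtain ⟨M, hM⟩ := isCompact_Icc.exists_bound_of_continuousOn hk
  have hc : ∀ y, ContinuousOn (fun x => k x * ((φ (x, y) : ℝ) : ℂ)) (Set.Icc a b) := by
    intro y
    have : Continuous fun x => φ (x, y) := by fun_prop
    fun_prop
  have hc' : ContinuousOn (fun x => k x * ((fderiv ℝ φ (x, y) (0, 1) : ℝ) : ℂ))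
      (Set.Icc a b) := by
    have : Continuous fun x => fderiv ℝ φ (x, y) (0, 1) :=
      hφ'.comp (f := fun x => (x, y)) (by fun_prop)
    fun_prop
  have hsub : Set.uIoc a b ⊆ Set.Icc a b := by
    rw [Set.uIoc_of_le hab]; exact Set.Ioc_subset_Icc_self
  refine (intervalIntegral.hasDerivAt_integral_of_dominated_loc_of_deriv_le
    (F := fun y x => k x * ((φ (x, y) : ℝ) : ℂ))
    (F' := fun y x => k x * ((fderiv ℝ φ (x, y) (0, 1) : ℝ) : ℂ))
    (bound := fun _ => M * (D * ‖((0, 1) : ℝ × ℝ)‖)) (s := Set.univ) (x₀ := y)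
    Filter.univ_mem ?_ ?_ ?_ ?_ intervalIntegrable_const ?_).2
  · exact Eventually.of_forall fun y =>
      ((hc y).mono hsub).aestronglyMeasurable measurableSet_uIoc
  · exact (hI ▸ hc y).intervalIntegrable
  · exact (hc'.mono hsub).aestronglyMeasurable measurableSet_uIoc
  · refine Eventually.of_forall fun x hx y _ => ?_
    rw [norm_mul, Complex.norm_real]
    exact mul_le_mul (hM x (hsub hx))
      (((fderiv ℝ φ (x, y)).le_opNorm _).trans (by gcongr; exact hD _)) (norm_nonneg _)
      ((norm_nonneg _).trans (hM x (hsub hx)))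
  · refine Eventually.of_forall fun x hx y _ => ?_
    have h1 : HasDerivAt (fun y => φ (x, y)) (fderiv ℝ φ (x, y) (0, 1)) y :=
      ((hφ.differentiable (by simp)) (x, y)).hasFDerivAt.comp_hasDerivAt y
        ((hasDerivAt_const y x).prodMk (hasDerivAt_id y))
    exact h1.ofReal_comp.const_mul _

theorem HasCompactSupport.exists_radius {φ : ℝ × ℝ → ℝ} (hφc : HasCompactSupport φ) :
    ∃ R : ℝ, 1 ≤ R ∧ ∀ x y, R ≤ x ∨ R ≤ y → φ (x, y) = 0 := by
  obtain ⟨r, hr⟩ := hφc.isCompact.isBounded.subset_closedBall 0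
  refine ⟨max 1 (r + 1), le_max_left _ _, fun x y h => ?_⟩
  by_contra hne
  have h1 := hr (subset_tsupport φ hne)
  rw [mem_closedBall_zero_iff, Prod.norm_def, max_le_iff] at h1
  have h2 := le_max_right 1 (r + 1)
  rcases h with h | h
  · linarith [le_abs_self x, h1.1, Real.norm_eq_abs x]
  · linarith [le_abs_self y, h1.2, Real.norm_eq_abs y]

theorem continuousOn_exp_flat_phase (p t : ℝ) {a b : ℝ} (ha : 0 < a) :
    ContinuousOn (fun x : ℝ =>
      Complex.exp (Complex.I * (t : ℂ) * ((Real.exp (-1 / x ^ p) : ℝ) : ℂ))) (Set.Icc a b) := by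
  have h1 : ContinuousOn (fun x : ℝ => -1 / x ^ p) (Set.Icc a b) := by
    refine continuousOn_const.div (continuousOn_id.rpow_const fun x hx => ?_) fun x hx => ?_
    · exact Or.inl (ha.trans_le hx.1).ne'
    · exact (Real.rpow_pos_of_pos (ha.trans_le hx.1) _).ne'
  fun_prop

theorem Ltwo_eq_intervalIntegral {p t R : ℝ} {ψ : ℝ → ℝ} (hR : Real.log t ^ (-(1 / p)) ≤ R)
    (hψ : ∀ x, R ≤ x → ψ x = 0) :
    Ltwo p t ψ = ∫ x in (Real.log t ^ (-(1 / p)))..R,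
      Complex.exp (Complex.I * (t : ℂ) * ((Real.exp (-1 / x ^ p) : ℝ) : ℂ)) * ((ψ x : ℝ) : ℂ) := by
  rw [Ltwo, intervalIntegral.integral_of_le hR]
  refine setIntegral_eq_of_subset_of_forall_sdiff_eq_zero measurableSet_Ioi
    Set.Ioc_subset_Ioi_self fun x hx => ?_
  rw [hψ x (le_of_not_ge fun h => hx.2 ⟨hx.1, h⟩)]
  simp

theorem norm_integral_exp_flat_phase_le {p t a s R : ℝ} (hp : 0 < p) (ht : 0 < t) (ha : 0 < a)
    (hs : a ≤ s) (hsR : s ≤ R) :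
    ‖∫ x in a..s, Complex.exp (Complex.I * (t : ℂ) * ((Real.exp (-1 / x ^ p) : ℝ) : ℂ))‖ ≤
      2 * (a ^ (p + 1) * Real.exp (a ^ (-p)) / (t * p)) +
        2 * (Real.exp ((p + 1) / p) * ((p + 1) * R ^ p) / (t * p)) * R := by
  set K := Real.exp ((p + 1) / p) * ((p + 1) * R ^ p) / (t * p)
  have hR : 0 < R := by linarith
  have hK : 0 ≤ K := by positivity
  have main := norm_integral_exp_phase_le hs hK
    (F := fun x => t * Real.exp (-x ^ (-p)))
    (F' := fun x => t * (Real.exp (-x ^ (-p)) * (p * x ^ (-p - 1))))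
    (u := fun x => x ^ (p + 1) * Real.exp (x ^ (-p)) / (t * p))
    (u' := fun x => Real.exp (x ^ (-p)) * ((p + 1) * x ^ p - p) / (t * p))
    (fun x hx => by
      have hx0 : 0 < x := ha.trans_le hx.1
      have := ((Real.hasDerivAt_rpow_const (x := x) (p := -p) (Or.inl hx0.ne')).fun_neg.exp).const_mul t
      refine this.congr_deriv ?_
      ring)
    (fun x hx => by
      have hx0 : 0 < x := ha.trans_le hx.1
      have := ((Real.hasDerivAt_rpow_const (x := x) (p := p + 1) (Or.inl hx0.ne')).mul
        (Real.hasDerivAt_rpow_const (x := x) (p := -p) (Or.inl hx0.ne')).exp).div_const (t * p)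
      refine this.congr_deriv ?_
      have h1 : x ^ (p + 1) * x ^ (-p - 1) = 1 := by
        rw [← Real.rpow_add hx0]; simp
      rw [add_sub_cancel_right]
      congr 1
      linear_combination -(p * Real.exp (x ^ (-p))) * h1)
    (fun x hx => by
      have hx0 : 0 < x := ha.trans_le hx.1
      have h1 : x ^ (p + 1) * x ^ (-p - 1) = 1 := by
        rw [← Real.rpow_add hx0]; simp
      have h2 : Real.exp (-x ^ (-p)) * Real.exp (x ^ (-p)) = 1 := by
        rw [← Real.exp_add]; simp
      calc _ = (x ^ (p + 1) * x ^ (-p - 1)) * (Real.exp (-x ^ (-p)) * Real.exp (x ^ (-p)))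
            * (t * p / (t * p)) := by ring
        _ = 1 := by rw [h1, h2, div_self (by positivity)]; simp)
    (fun x hx => by
      have hx0 : 0 < x := ha.trans_le hx.1
      positivity)
    (by
      have h1 : ∀ r : ℝ, ContinuousOn (fun x : ℝ => x ^ r) (Set.Icc a s) := fun r =>
        continuousOn_id.rpow_const fun x hx => Or.inl (ha.trans_le hx.1).ne'
      have h2 := h1 p
      have h3 := h1 (-p)
      fun_prop)
    (fun x hx => by
      have hx0 : 0 < x := ha.trans_le hx.1
      have hxp : 0 < x ^ p := by positivity
      rcases le_total ((p + 1) * x ^ p) p with h | h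
      · refine le_trans ?_ hK
        exact div_nonpos_of_nonpos_of_nonneg
          (mul_nonpos_of_nonneg_of_nonpos (Real.exp_pos _).le (by linarith)) (by positivity)
      · have h1 : x ^ (-p) ≤ (p + 1) / p := by
          rw [Real.rpow_neg hx0.le, inv_le_comm₀ hxp (by positivity), inv_div,
            div_le_iff₀ (by positivity)]
          linarith
        have h2 : x ^ p ≤ R ^ p := Real.rpow_le_rpow hx0.le (hx.2.trans hsR) hp.le
        refine div_le_div_of_nonneg_right ?_ (by positivity)
        refine mul_le_mul (Real.exp_le_exp.2 h1) ?_ (by linarith) (Real.exp_pos _).le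
        have := mul_le_mul_of_nonneg_left h2 (by linarith : 0 ≤ p + 1)
        linarith)
  have hint : (∫ x in a..s, Complex.exp (Complex.I * (t : ℂ) * ((Real.exp (-1 / x ^ p) : ℝ) : ℂ)))
      = ∫ x in a..s, Complex.exp (Complex.I * ((t * Real.exp (-x ^ (-p)) : ℝ) : ℂ)) := by
    refine intervalIntegral.integral_congr fun x hx => ?_
    rw [Set.uIcc_of_le hs] at hx
    have hx0 : 0 < x := ha.trans_le hx.1
    have h1 : -1 / x ^ p = -x ^ (-p) := by
      rw [Real.rpow_neg hx0.le, neg_div, one_div]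
    simp only [h1, Complex.ofReal_mul, mul_assoc]
  rw [hint]
  refine main.trans ?_
  have : 2 * K * (s - a) ≤ 2 * K * R := by gcongr; linarith
  simpa using this

theorem exists_norm_integral_exp_flat_phase_le {p R : ℝ} (hp : 0 < p) (hR : 0 < R) :
    ∃ C > (0 : ℝ), ∃ t₀ > (1 : ℝ), ∀ t ≥ t₀, 1 ≤ Real.log t ∧
      ∀ s ∈ Set.Icc (Real.log t ^ (-(1 / p))) R,
      ‖∫ x in (Real.log t ^ (-(1 / p)))..s,
        Complex.exp (Complex.I * (t : ℂ) * ((Real.exp (-1 / x ^ p) : ℝ) : ℂ))‖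
        ≤ C * Real.log t ^ (-(1 / p + 1)) := by
  have hlo := (isLittleO_log_rpow_rpow_atTop (1 / p + 1) one_pos).bound one_pos
  have hlog := Real.tendsto_log_atTop.eventually_ge_atTop 1
  obtain ⟨t₁, ht₁⟩ := eventually_atTop.1 (hlo.and hlog)
  refine ⟨2 / p + 2 * (Real.exp ((p + 1) / p) * ((p + 1) * R ^ p) / p) * R, by positivity,
    max t₁ 2, lt_of_lt_of_le one_lt_two (le_max_right _ _), fun t ht => ?_⟩
  obtain ⟨h1, h2⟩ := ht₁ t ((le_max_left _ _).trans ht)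
  have ht0 : 0 < t := lt_of_lt_of_le two_pos ((le_max_right _ _).trans ht)
  have hl : 0 < Real.log t := by linarith
  refine ⟨h2, fun s hs => ?_⟩
  refine (norm_integral_exp_flat_phase_le hp ht0 (by positivity) hs.1 hs.2).trans ?_
  have hinv : 1 / t ≤ Real.log t ^ (-(1 / p + 1)) := by
    rw [Real.norm_of_nonneg (by positivity), Real.norm_of_nonneg (by positivity), one_mul,
      Real.rpow_one] at h1
    rw [Real.rpow_neg hl.le, ← one_div]
    exact one_div_le_one_div_of_le (by positivity) h1
  have e1 : (Real.log t ^ (-(1 / p))) ^ (-p) = Real.log t := by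
    rw [← Real.rpow_mul hl.le]
    have : -(1 / p) * -p = 1 := by field_simp
    rw [this, Real.rpow_one]
  have e2 : (Real.log t ^ (-(1 / p))) ^ (p + 1) = Real.log t ^ (-(1 / p + 1)) := by
    rw [← Real.rpow_mul hl.le]
    congr 1
    field_simp
    ring
  rw [e1, e2, Real.exp_log ht0]
  have e3 : 2 * (Real.log t ^ (-(1 / p + 1)) * t / (t * p))
      = 2 / p * Real.log t ^ (-(1 / p + 1)) := by
    field_simp
  have e4 : 2 * (Real.exp ((p + 1) / p) * ((p + 1) * R ^ p) / (t * p)) * R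
      = 2 * (Real.exp ((p + 1) / p) * ((p + 1) * R ^ p) / p) * R * (1 / t) := by
    field_simp
  rw [e3, e4, add_mul (2 / p)]
  gcongr

theorem exists_norm_Ltwo_le_s18 {p : ℝ} (hp : 0 < p) {φ : ℝ × ℝ → ℝ}
    (hφ : ContDiff ℝ (⊤ : ℕ∞) φ) (hφc : HasCompactSupport φ) :
    ∃ C > (0 : ℝ), ∃ t₀ > (1 : ℝ), ∀ t ≥ t₀, 1 ≤ Real.log t ∧
      ∀ y, ‖Ltwo p t (fun x => φ (x, y))‖ ≤ C * Real.log t ^ (-(1 / p + 1)) := by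
  obtain ⟨R, hR1, hR⟩ := hφc.exists_radius
  obtain ⟨C, hC, t₀, ht₀, H⟩ := exists_norm_integral_exp_flat_phase_le hp (by linarith : 0 < R)
  have hφ' : Continuous fun z => fderiv ℝ φ z (1, 0) :=
    (hφ.continuous_fderiv (by simp)).clm_apply continuous_const
  obtain ⟨D, hD⟩ := (hφc.fderiv_apply ℝ (1, 0)).exists_bound_of_continuous hφ'
  have hD0 : 0 ≤ D := (norm_nonneg _).trans (hD 0)
  refine ⟨C * (D + 1) * R, by positivity, t₀, ht₀, fun t ht => ?_⟩
  obtain ⟨hl, H⟩ := H t ht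
  refine ⟨hl, fun y => ?_⟩
  have ha : 0 < Real.log t ^ (-(1 / p)) := by positivity
  have haR : Real.log t ^ (-(1 / p)) ≤ R :=
    (Real.rpow_le_one_of_one_le_of_nonpos hl (by simp; positivity)).trans hR1
  rw [Ltwo_eq_intervalIntegral haR fun x hx => hR x y (Or.inl hx)]
  have main := norm_integral_mul_amplitude_le haR (continuousOn_exp_flat_phase p t ha) H
    (ψ := fun x => ((φ (x, y) : ℝ) : ℂ)) (ψ' := fun x => ((fderiv ℝ φ (x, y) (1, 0) : ℝ) : ℂ))
    (D := D)
    (fun x => by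
      have h1 : HasDerivAt (fun x => φ (x, y)) (fderiv ℝ φ (x, y) (1, 0)) x :=
        ((hφ.differentiable (by simp)) (x, y)).hasFDerivAt.comp_hasDerivAt x
          ((hasDerivAt_id x).prodMk (hasDerivAt_const x y))
      exact h1.ofReal_comp)
    (Complex.continuous_ofReal.comp (hφ'.comp (f := fun x => (x, y)) (by fun_prop)))
    (fun x => by rw [Complex.norm_real]; exact hD _)
    (by rw [hR R y (Or.inl le_rfl), Complex.ofReal_zero])
  refine main.trans ?_
  calc _ ≤ C * Real.log t ^ (-(1 / p + 1)) * (D + 1) * R := by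
        gcongr
        · linarith
        · linarith
    _ = _ := by ring

/-- Uniform boundedness of the truncated integrals `∫₀ˢ e^{i z^q} β(z) dz`. -/
theorem exists_norm_integral_exp_pow_mul_le {q : ℕ} (hq : 2 ≤ q) {β : ℝ → ℝ} (hβ : Continuous β)
    (hβ1 : ∀ x : ℝ, 2 ≤ |x| → β x = 1) :
    ∃ C > (0 : ℝ), ∀ s, 0 ≤ s →
      ‖∫ z in (0 : ℝ)..s, Complex.exp (Complex.I * ((z ^ q : ℝ) : ℂ)) * (β z : ℂ)‖ ≤ C := by
  obtain ⟨M, hM⟩ := (isCompact_Icc (a := (0 : ℝ)) (b := 2)).exists_bound_of_continuousOn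
    hβ.continuousOn
  have hM0 : 0 ≤ M := (norm_nonneg _).trans (hM 0 ⟨le_rfl, two_pos.le⟩)
  have hcont : Continuous fun z : ℝ =>
      Complex.exp (Complex.I * ((z ^ q : ℝ) : ℂ)) * (β z : ℂ) := by fun_prop
  have hsmall : ∀ s, 0 ≤ s → s ≤ 2 →
      ‖∫ z in (0 : ℝ)..s, Complex.exp (Complex.I * ((z ^ q : ℝ) : ℂ)) * (β z : ℂ)‖ ≤ M * 2 := by
    intro s h0 h2
    refine (intervalIntegral.norm_integral_le_of_norm_le_const (C := M) fun z hz => ?_).trans ?_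
    · rw [Set.uIoc_of_le h0] at hz
      rw [norm_mul, mul_comm Complex.I, Complex.norm_exp_ofReal_mul_I, one_mul, Complex.norm_real]
      exact hM z ⟨hz.1.le, hz.2.trans h2⟩
    · rw [sub_zero, abs_of_nonneg h0]; gcongr
  have hq0 : (0 : ℝ) < q := by positivity
  refine ⟨M * 2 + 2 * ((q : ℝ)⁻¹ * (2 ^ (q - 1))⁻¹), by positivity, fun s hs => ?_⟩
  rcases le_total s 2 with h2 | h2
  · exact (hsmall s hs h2).trans (le_add_of_nonneg_right (by positivity))
  rw [← intervalIntegral.integral_add_adjacent_intervals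
    (hcont.intervalIntegrable 0 2) (hcont.intervalIntegrable 2 s)]
  refine (norm_add_le _ _).trans (add_le_add (hsmall 2 two_pos.le le_rfl) ?_)
  have hint : (∫ z in (2 : ℝ)..s, Complex.exp (Complex.I * ((z ^ q : ℝ) : ℂ)) * (β z : ℂ))
      = ∫ z in (2 : ℝ)..s, Complex.exp (Complex.I * ((z ^ q : ℝ) : ℂ)) := by
    refine intervalIntegral.integral_congr fun z hz => ?_
    rw [Set.uIcc_of_le h2] at hz
    simp [hβ1 z (hz.1.trans (le_abs_self z))]
  rw [hint]
  have main := norm_integral_exp_phase_le h2 le_rfl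
    (F := fun z => z ^ q) (F' := fun z => q * z ^ (q - 1))
    (u := fun z => (q : ℝ)⁻¹ * (z ^ (q - 1))⁻¹)
    (u' := fun z => (q : ℝ)⁻¹ * (-(((q - 1 : ℕ) : ℝ) * z ^ (q - 1 - 1)) / (z ^ (q - 1)) ^ 2))
    (fun z _ => hasDerivAt_pow q z)
    (fun z hz => ((hasDerivAt_pow (q - 1) z).fun_inv
      (pow_pos (two_pos.trans_le hz.1) _).ne').const_mul _)
    (fun z hz => by
      have : 0 < z := two_pos.trans_le hz.1
      field_simp)
    (fun z hz => by
      have : 0 < z := two_pos.trans_le hz.1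
      positivity)
    (by
      refine continuousOn_const.mul (ContinuousOn.div (by fun_prop) (by fun_prop) fun z hz => ?_)
      have : 0 < z := two_pos.trans_le hz.1
      positivity)
    (fun z hz => by
      have : 0 < z := two_pos.trans_le hz.1
      rw [neg_div, mul_neg, neg_nonpos]
      positivity)
  simpa using main

theorem exists_norm_integral_exp_pow_mul_scaled_le {q : ℕ} (hq : 2 ≤ q) {β : ℝ → ℝ}
    (hβ : Continuous β) (hβ1 : ∀ x : ℝ, 2 ≤ |x| → β x = 1) :
    ∃ C > (0 : ℝ), ∀ t > (0 : ℝ), ∀ s, 0 ≤ s →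
      ‖∫ y in (0 : ℝ)..s, Complex.exp (Complex.I * (t : ℂ) * ((y ^ q : ℝ) : ℂ)) *
        ((β (t ^ (1 / (q : ℝ)) * y) : ℝ) : ℂ)‖ ≤ C * t ^ (-(1 / (q : ℝ))) := by
  obtain ⟨C, hC, H⟩ := exists_norm_integral_exp_pow_mul_le hq hβ hβ1
  refine ⟨C, hC, fun t ht s hs => ?_⟩
  have hτ : 0 < t ^ (1 / (q : ℝ)) := by positivity
  have hpow : (t ^ (1 / (q : ℝ))) ^ q = t := by
    rw [one_div, Real.rpow_inv_natCast_pow ht.le (by omega)]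
  have hsub := intervalIntegral.integral_comp_mul_left (a := 0) (b := s)
    (fun z : ℝ => Complex.exp (Complex.I * ((z ^ q : ℝ) : ℂ)) * (β z : ℂ)) hτ.ne'
  simp only [mul_pow, hpow, Complex.ofReal_mul, ← mul_assoc] at hsub
  rw [hsub, norm_smul, norm_inv, Real.norm_of_nonneg hτ.le, ← Real.rpow_neg ht.le, mul_zero,
    mul_comm C]
  gcongr
  exact H _ (by positivity)

theorem stmt18 (p : ℝ) (hp : 0 < p) (q : ℕ) (hq : 2 ≤ q)
    (φ : ℝ × ℝ → ℝ) (hφ : ContDiff ℝ (⊤ : ℕ∞) φ) (hφc : HasCompactSupport φ)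
    (β : ℝ → ℝ) (hβ : ContDiff ℝ (⊤ : ℕ∞) β)
    (hβ0 : ∀ x : ℝ, |x| ≤ 1 → β x = 0) (hβ1 : ∀ x : ℝ, 2 ≤ |x| → β x = 1) :
    ∃ C > (0 : ℝ), ∃ t₀ > (1 : ℝ), ∀ t ≥ t₀,
      ‖Ntwo p q φ β t‖ ≤ C * t ^ (-(1 / (q : ℝ))) * (Real.log t) ^ (-(1 / p + 1)) := by
  set φ' : ℝ × ℝ → ℝ := fun z => fderiv ℝ φ z (0, 1)
  have hφ' : ContDiff ℝ (⊤ : ℕ∞) φ' := (hφ.fderiv_right (by simp)).clm_apply contDiff_const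
  have hφ'c : HasCompactSupport φ' := hφc.fderiv_apply ℝ (0, 1)
  obtain ⟨R₁, hR₁1, hR₁⟩ := hφc.exists_radius
  obtain ⟨R₂, -, hR₂⟩ := hφ'c.exists_radius
  obtain ⟨R, hR1, hR, hR'⟩ : ∃ R : ℝ, 1 ≤ R ∧ (∀ x y, R ≤ x ∨ R ≤ y → φ (x, y) = 0) ∧
      ∀ x y, R ≤ x ∨ R ≤ y → φ' (x, y) = 0 :=
    ⟨max R₁ R₂, hR₁1.trans (le_max_left _ _),
      fun x y h => hR₁ x y (h.imp (le_max_left _ _).trans (le_max_left _ _).trans),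
      fun x y h => hR₂ x y (h.imp (le_max_right _ _).trans (le_max_right _ _).trans)⟩
  have hR0 : 0 < R := by linarith
  obtain ⟨C₁, hC₁, t₀, ht₀, H₁⟩ := exists_norm_Ltwo_le_s18 hp hφ' hφ'c
  obtain ⟨C₂, hC₂, H₂⟩ := exists_norm_integral_exp_pow_mul_scaled_le hq hβ.continuous hβ1
  refine ⟨C₂ * C₁ * R, by positivity, t₀, ht₀, fun t ht => ?_⟩
  obtain ⟨hl, H₁⟩ := H₁ t ht
  have ht0 : 0 < t := by linarith
  have ha : 0 < Real.log t ^ (-(1 / p)) := by positivity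
  have haR : Real.log t ^ (-(1 / p)) ≤ R :=
    (Real.rpow_le_one_of_one_le_of_nonpos hl (by simp; positivity)).trans hR1
  have hk := continuousOn_exp_flat_phase p t (b := R) ha
  have hL : (fun y => Ltwo p t fun x => φ (x, y)) = _ :=
    funext fun y => Ltwo_eq_intervalIntegral haR fun x hx => hR x y (Or.inl hx)
  have hL' : (fun y => Ltwo p t fun x => φ' (x, y)) = _ :=
    funext fun y => Ltwo_eq_intervalIntegral haR fun x hx => hR' x y (Or.inl hx)
  have hderiv : ∀ y, HasDerivAt (fun y => Ltwo p t fun x => φ (x, y))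
      (Ltwo p t fun x => φ' (x, y)) y := fun y => by
    rw [hL, congrFun hL' y]
    exact hasDerivAt_integral_mul_slice haR hk hφ hφc y
  have hcont : Continuous fun y => Ltwo p t fun x => φ' (x, y) := by
    rw [hL']
    exact continuous_iff_continuousAt.2 fun y =>
      (hasDerivAt_integral_mul_slice haR hk hφ' hφ'c y).continuousAt
  have hzero : ∀ y, R ≤ y → (Ltwo p t fun x => φ (x, y)) = 0 := fun y hy => by
    simp [Ltwo, hR _ y (Or.inr hy)]
  have hN : Ntwo p q φ β t = ∫ y in (0 : ℝ)..R,
      (Complex.exp (Complex.I * (t : ℂ) * ((y ^ q : ℝ) : ℂ)) *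
        ((β (t ^ (1 / (q : ℝ)) * y) : ℝ) : ℂ)) * Ltwo p t (fun x => φ (x, y)) := by
    rw [Ntwo, intervalIntegral.integral_of_le hR0.le]
    simp only [mul_right_comm _ (Ltwo _ _ _)]
    refine setIntegral_eq_of_subset_of_forall_sdiff_eq_zero measurableSet_Ioi
      Set.Ioc_subset_Ioi_self fun y hy => ?_
    rw [hzero y (le_of_not_ge fun h => hy.2 ⟨hy.1, h⟩), mul_zero]
  have hβc := hβ.continuous
  rw [hN]
  refine (norm_integral_mul_amplitude_le hR0.le (Continuous.continuousOn (by fun_prop))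
    (fun s hs => H₂ t ht0 s hs.1) hderiv hcont H₁ (hzero R le_rfl)).trans (le_of_eq ?_)
  ring
end
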